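/- For every t with 0 < t ≤ C_d/(6·d·A_d), with probability at least 1 − 4d²·exp(−2nt²), the empirical covariance matrix Σ̂ is invertible and ‖Σ̂⁻¹‖_op ≤ 6·d·A_d/C_d. -/

import Mathlib

open Real MeasureTheory ProbabilityTheory Matrix

/-- The ℓ²→ℓ² operator norm (spectral norm) of a square real matrix. -/
noncomputable def matOpNorm {m : ℕ} (M : Matrix (Fin m) (Fin m) ℝ) : ℝ :=
  ‖Matrix.toEuclideanCLM (𝕜 := ℝ) M‖

/-- A square matrix whose quadratic form is bounded below by `κ > 0` is invertible, and its
inverse has operator norm at most `κ⁻¹`. -/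
theorem isUnit_and_matOpNorm_inv_le {m : ℕ} {M : Matrix (Fin m) (Fin m) ℝ} {κ : ℝ} (hκ : 0 < κ)
    (h : ∀ v : Fin m → ℝ, κ * (v ⬝ᵥ v) ≤ v ⬝ᵥ M *ᵥ v) :
    IsUnit M ∧ matOpNorm M⁻¹ ≤ κ⁻¹ := by
  have hM : IsUnit M := by
    rw [← mulVec_injective_iff_isUnit, ← coe_mulVecLin, injective_iff_map_eq_zero]
    intro v hv
    have hv' : M *ᵥ v = 0 := hv
    have h1 := h v
    rw [hv', dotProduct_zero] at h1
    have h2 : v ⬝ᵥ v = 0 :=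
      le_antisymm (nonpos_of_mul_nonpos_right h1 hκ) (by simpa using dotProduct_star_self_nonneg v)
    exact dotProduct_self_eq_zero.1 h2
  refine ⟨hM, ContinuousLinearMap.opNorm_le_bound _ (inv_nonneg.2 hκ.le) fun x => ?_⟩
  set y := toEuclideanCLM (𝕜 := ℝ) M⁻¹ x with hy
  have hMy : toEuclideanCLM (𝕜 := ℝ) M y = x := by
    rw [hy, ← mul_apply_eq_comp, ← map_mul,
      mul_nonsing_inv _ ((isUnit_iff_isUnit_det M).1 hM), map_one, one_apply_eq_self]
  have h1 : κ * ‖y‖ ^ 2 ≤ inner ℝ y x := by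
    rw [← hMy, inner_toEuclideanCLM, EuclideanSpace.real_norm_sq_eq]
    simpa [dotProduct, sq, dotProduct_mulVec] using h y.ofLp
  have h2 : inner ℝ y x ≤ ‖y‖ * ‖x‖ := real_inner_le_norm y x
  rw [inv_mul_eq_div, le_div_iff₀ hκ]
  rcases (norm_nonneg y).eq_or_lt with h0 | h0
  · rw [← h0]; simp
  · nlinarith

/-- A quadratic form whose matrix has off-diagonal entries at most `t` in absolute value and
diagonal entries at least `l - t` is bounded below by `l - m * t`. -/
theorem quadratic_form_ge_of_entries {m : ℕ} {S : Fin m → Fin m → ℝ} {l t : ℝ} (ht : 0 ≤ t)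
    (hdiag : ∀ a, l - t ≤ S a a) (hoff : ∀ a b, a ≠ b → |S a b| ≤ t) (w : Fin m → ℝ) :
    (l - m * t) * ∑ a, w a ^ 2 ≤ ∑ a, ∑ b, w a * w b * S a b := by
  have hterm : ∀ a b, (if a = b then l * w a ^ 2 else 0) - t * (|w a| * |w b|)
      ≤ w a * w b * S a b := by
    intro a b
    split_ifs with hab
    · subst hab
      rw [abs_mul_abs_self]
      nlinarith [hdiag a, mul_self_nonneg (w a)]
    · have h1 : |w a * w b * S a b| ≤ t * (|w a| * |w b|) := by
        rw [abs_mul, abs_mul, mul_comm]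
        exact mul_le_mul_of_nonneg_right (hoff a b hab) (by positivity)
      linarith [neg_abs_le (w a * w b * S a b)]
  have hsq : (∑ a, |w a|) ^ 2 ≤ m * ∑ a, w a ^ 2 := by
    simpa using sq_sum_le_card_mul_sum_sq (s := Finset.univ) (f := fun a => |w a|)
  calc (l - m * t) * ∑ a, w a ^ 2 = l * ∑ a, w a ^ 2 - t * (m * ∑ a, w a ^ 2) := by ring
    _ ≤ l * ∑ a, w a ^ 2 - t * (∑ a, |w a|) ^ 2 := by gcongr
    _ = ∑ a, ∑ b, ((if a = b then l * w a ^ 2 else 0) - t * (|w a| * |w b|)) := by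
      simp_rw [Finset.sum_sub_distrib, ← Finset.mul_sum, ← Finset.sum_mul]
      simp [Finset.mul_sum, sq]
    _ ≤ _ := Finset.sum_le_sum fun a _ => Finset.sum_le_sum fun b _ => hterm a b

/-- Hoeffding's lower tail bound for the empirical mean of i.i.d. variables with values in an
interval of length one. -/
theorem hoeffding_empirical_mean {E : Type*} [MeasurableSpace E] (Q : Measure E)
    [IsProbabilityMeasure Q] {n : ℕ} (hn : 1 ≤ n) {f : E → ℝ} (hf : Measurable f) {lo : ℝ}
    (hlo : ∀ x, f x ∈ Set.Icc lo (lo + 1)) {t : ℝ} (ht : 0 ≤ t) :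
    (Measure.pi fun _ : Fin n => Q) {ω | (n : ℝ)⁻¹ * ∑ i, f (ω i) ≤ (∫ x, f x ∂Q) - t}
      ≤ ENNReal.ofReal (Real.exp (-2 * n * t ^ 2)) := by
  set P := Measure.pi fun _ : Fin n => Q
  have hn0 : (0 : ℝ) < n := by exact_mod_cast hn
  have hint : ∀ i : Fin n, ∫ ω, -f (ω i) ∂P = -∫ x, f x ∂Q := fun i => by
    rw [integral_comp_eval (μ := fun _ : Fin n => Q) (f := fun x => -f x)
      (by fun_prop), integral_neg]
  have hind : iIndepFun (fun i (ω : Fin n → E) => -f (ω i) - ∫ ω, -f (ω i) ∂P) P :=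
    iIndepFun_pi (μ := fun _ : Fin n => Q) (X := fun i x => -f x - ∫ ω, -f (ω i) ∂P)
      fun i => by fun_prop
  have hsub : ∀ i ∈ (Finset.univ : Finset (Fin n)),
      HasSubgaussianMGF (fun ω : Fin n → E => -f (ω i) - ∫ ω, -f (ω i) ∂P)
        ((‖(-lo) - (-(lo + 1))‖₊ / 2) ^ 2) P := fun i _ =>
    hasSubgaussianMGF_of_mem_Icc (hf.comp (measurable_pi_apply i)).neg.aemeasurable
      (ae_of_all _ fun ω => ⟨neg_le_neg (hlo _).2, neg_le_neg (hlo _).1⟩)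
  have key := HasSubgaussianMGF.measure_sum_ge_le_of_iIndepFun hind hsub
    (ε := n * t) (by positivity)
  rw [← ENNReal.ofReal_toReal (measure_ne_top P _)]
  refine ENNReal.ofReal_le_ofReal (le_trans (le_of_eq ?_) (key.trans (le_of_eq ?_)))
  · change P.real _ = P.real _
    congr 1
    ext ω
    simp only [Set.mem_ofPred_eq, hint, Finset.sum_sub_distrib, Finset.sum_neg_distrib,
      Finset.sum_const, Finset.card_univ, Fintype.card_fin, nsmul_eq_mul]
    rw [inv_mul_le_iff₀ hn0]
    constructor <;> intro h <;> linarith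
  · congr 1
    simp
    field_simp

/-- A product of a weight in `[0, 1]` with two centred indicator values ranges over an interval of
length one. -/
theorem exists_interval_mul_centered {α β : ℝ} (hα : α ∈ Set.Icc 0 1) (hβ : β ∈ Set.Icc 0 1) :
    ∃ lo : ℝ, ∀ p ∈ Set.Icc (0 : ℝ) 1, ∀ u v : ℝ, (u = -α ∨ u = 1 - α) → (v = -β ∨ v = 1 - β) →
      p * (u * v) ∈ Set.Icc lo (lo + 1) := by
  wlog hαβ : α ≤ β generalizing α β
  · obtain ⟨lo, h⟩ := this hβ hα (le_of_not_ge hαβ)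
    exact ⟨lo, fun p hp u v hu hv => mul_comm u v ▸ h p hp v u hv hu⟩
  obtain ⟨ha0, ha1⟩ := hα
  obtain ⟨hb0, hb1⟩ := hβ
  refine ⟨-(β * (1 - α)), fun p ⟨hp0, hp1⟩ u v hu hv => ?_⟩
  have hB : 0 ≤ β * (1 - α) := mul_nonneg hb0 (by linarith)
  have hB1 : β * (1 - α) ≤ 1 := by nlinarith
  have huv : -(β * (1 - α)) ≤ u * v ∧ u * v ≤ -(β * (1 - α)) + 1 := by
    rcases hu with rfl | rfl <;> rcases hv with rfl | rfl <;> constructor <;> nlinarith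
  constructor <;> nlinarith [huv.1, huv.2]

/-- Weighting a Gaussian density by a Gaussian kernel gives a multiple of a Gaussian density. -/
theorem gaussianPDFReal_mul_exp (m ξ : ℝ) {σ ν : ℝ} (hσ : 0 < σ) (hν : 0 < ν) {v w : NNReal}
    (hv : (v : ℝ) = σ ^ 2) (hw : (w : ℝ) = (ν * σ / √(ν ^ 2 + σ ^ 2)) ^ 2) (x : ℝ) :
    gaussianPDFReal m v x * Real.exp (-(x - ξ) ^ 2 / (2 * ν ^ 2)) =
      (ν / √(ν ^ 2 + σ ^ 2) * Real.exp (-(ξ - m) ^ 2 / (2 * (ν ^ 2 + σ ^ 2)))) *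
        gaussianPDFReal ((ν ^ 2 * m + σ ^ 2 * ξ) / (ν ^ 2 + σ ^ 2)) w x := by
  have hs : 0 < ν ^ 2 + σ ^ 2 := by positivity
  have hsq : √(ν ^ 2 + σ ^ 2) ^ 2 = ν ^ 2 + σ ^ 2 := Real.sq_sqrt hs.le
  have hr : 0 < √(ν ^ 2 + σ ^ 2) := Real.sqrt_pos.2 hs
  simp only [gaussianPDFReal, hv, hw]
  rw [Real.sqrt_mul (by positivity) (σ ^ 2), Real.sqrt_mul (by positivity) (_ ^ 2),
    Real.sqrt_sq hσ.le, Real.sqrt_sq (by positivity), mul_assoc, ← Real.exp_add,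
    mul_mul_mul_comm, ← Real.exp_add]
  congr 1
  · field_simp
  · congr 1
    rw [div_pow, hsq]
    field_simp
    ring

theorem integral_exp_mul_gaussianReal (m ξ : ℝ) {σ ν : ℝ} (hσ : 0 < σ) (hν : 0 < ν)
    {v w : NNReal} (hv : (v : ℝ) = σ ^ 2) (hw : (w : ℝ) = (ν * σ / √(ν ^ 2 + σ ^ 2)) ^ 2)
    (h : ℝ → ℝ) :
    ∫ x, Real.exp (-(x - ξ) ^ 2 / (2 * ν ^ 2)) * h x ∂gaussianReal m v =
      (ν / √(ν ^ 2 + σ ^ 2) * Real.exp (-(ξ - m) ^ 2 / (2 * (ν ^ 2 + σ ^ 2)))) *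
        ∫ x, h x ∂gaussianReal ((ν ^ 2 * m + σ ^ 2 * ξ) / (ν ^ 2 + σ ^ 2)) w := by
  have h1 : v ≠ 0 := by rw [← NNReal.coe_ne_zero, hv]; positivity
  have h2 : w ≠ 0 := by rw [← NNReal.coe_ne_zero, hw]; positivity
  rw [integral_gaussianReal_eq_integral_smul h1, integral_gaussianReal_eq_integral_smul h2,
    ← integral_const_mul]
  refine integral_congr_ae (ae_of_all _ fun x => ?_)
  simp only [smul_eq_mul]
  rw [← mul_assoc, gaussianPDFReal_mul_exp m ξ hσ hν hv hw, mul_assoc]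

theorem gaussianReal_real_Ico (m : ℝ) {s : ℝ} (hs : 0 < s) {v : NNReal} (hv : (v : ℝ) = s ^ 2)
    {a b : ℝ} (hab : a ≤ b) :
    (gaussianReal m v).real (Set.Ico a b) =
      ∫ x in a..b, Real.exp (-(x - m) ^ 2 / (2 * s ^ 2)) / (s * √(2 * Real.pi)) := by
  have h1 : v ≠ 0 := by rw [← NNReal.coe_ne_zero, hv]; positivity
  rw [measureReal_def, gaussianReal_apply_eq_integral _ h1, ENNReal.toReal_ofReal
    (integral_nonneg fun x => gaussianPDFReal_nonneg m v x), intervalIntegral.integral_of_le hab,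
    integral_Ico_eq_integral_Ioc]
  refine integral_congr_ae (ae_of_all _ fun x => ?_)
  simp only [gaussianPDFReal, hv]
  rw [Real.sqrt_mul (by positivity), Real.sqrt_sq hs.le, mul_comm (√(2 * Real.pi)), inv_mul_eq_div]

/-- First and second moments of a centred indicator. -/
theorem integral_indicator_sub_measureReal {E : Type*} [MeasurableSpace E] (Q : Measure E)
    [IsProbabilityMeasure Q] {s : Set E} (hs : MeasurableSet s) :
    ∫ x, (s.indicator 1 x - Q.real s) ∂Q = 0 ∧
      ∫ x, (s.indicator 1 x - Q.real s) * (s.indicator 1 x - Q.real s) ∂Q =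
        Q.real s * (1 - Q.real s) := by
  have hi : Integrable (s.indicator (1 : E → ℝ)) Q := (integrable_const (1 : ℝ)).indicator hs
  have h1 : ∫ x, s.indicator (1 : E → ℝ) x ∂Q = Q.real s := integral_indicator_one hs
  constructor
  · rw [integral_sub hi (integrable_const _), h1]
    simp
  · have : ∀ x, (s.indicator 1 x - Q.real s) * (s.indicator 1 x - Q.real s) =
        (1 - 2 * Q.real s) * s.indicator (1 : E → ℝ) x + Q.real s ^ 2 := by
      intro x
      by_cases hx : x ∈ s <;> simp [hx] <;> ring
    simp_rw [this]
    rw [integral_add (hi.const_mul _) (integrable_const _), integral_const_mul, h1]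
    simp
    ring

/-- The feature vector with a constant coordinate followed by functions of the coordinates of
`x`. -/
def featureVec {d : ℕ} (u : Fin d → ℝ → ℝ) (x : Fin d → ℝ) : Fin (d + 1) → ℝ :=
  Fin.cons 1 fun j => u j (x j)

theorem featureVec_eq_prod {d : ℕ} (u : Fin d → ℝ → ℝ) (x : Fin d → ℝ) (a : Fin (d + 1)) :
    featureVec u x a = ∏ l, if a = l.succ then u l (x l) else 1 := by
  refine Fin.cases ?_ (fun j => ?_) a
  · simp [featureVec, (Fin.succ_ne_zero _).symm]
  · simp [featureVec, Fin.succ_inj]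

/-- Under a product measure, the weighted second moment matrix of features that are centred for
the weights is diagonal. -/
theorem integral_prod_mul_featureVec {d : ℕ} (G : Fin d → Measure ℝ) [∀ l, SigmaFinite (G l)]
    (e u : Fin d → ℝ → ℝ) (c β : Fin d → ℝ) (h0 : ∀ l, ∫ y, e l y ∂G l = c l)
    (h1 : ∀ l, ∫ y, e l y * u l y ∂G l = 0)
    (h2 : ∀ l, ∫ y, e l y * (u l y * u l y) ∂G l = c l * β l) (a b : Fin (d + 1)) :
    ∫ x, (∏ l, e l (x l)) * (featureVec u x a * featureVec u x b) ∂Measure.pi G =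
      if a = b then (∏ l, c l) * (Fin.cons 1 β : Fin (d + 1) → ℝ) a else 0 := by
  have hprod : ∀ x : Fin d → ℝ, (∏ l, e l (x l)) * (featureVec u x a * featureVec u x b) =
      ∏ l, e l (x l) * ((if a = l.succ then u l (x l) else 1) *
        (if b = l.succ then u l (x l) else 1)) := fun x => by
    rw [featureVec_eq_prod, featureVec_eq_prod, Finset.prod_mul_distrib, Finset.prod_mul_distrib]
  simp_rw [hprod]
  rw [integral_fintype_prod_eq_prod fun l y => e l y * ((if a = l.succ then u l y else 1) *
        (if b = l.succ then u l y else 1))]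
  split_ifs with hab
  · subst hab
    refine Fin.cases ?_ (fun j => ?_) a
    · simp [(Fin.succ_ne_zero _).symm, h0]
    · have : ∀ l, ∫ y, e l y * ((if j.succ = l.succ then u l y else 1) *
          (if j.succ = l.succ then u l y else 1)) ∂G l = c l * if j = l then β l else 1 := by
        intro l
        by_cases hjl : j = l <;> simp [hjl, h0, h2]
      simp_rw [this, Finset.prod_mul_distrib]
      simp
  · have key : ∃ l : Fin d, (a = l.succ ∧ b ≠ l.succ) ∨ (a ≠ l.succ ∧ b = l.succ) := by
      rcases Fin.eq_zero_or_eq_succ a with rfl | ⟨j, rfl⟩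
      · obtain ⟨k, rfl⟩ := Fin.exists_succ_eq.2 (Ne.symm hab)
        exact ⟨k, Or.inr ⟨hab, rfl⟩⟩
      · exact ⟨j, Or.inl ⟨rfl, Ne.symm hab⟩⟩
    obtain ⟨l, hl⟩ := key
    refine Finset.prod_eq_zero (Finset.mem_univ l) ?_
    rcases hl with ⟨ha, hb⟩ | ⟨ha, hb⟩ <;> simp [ha, hb, h1]

theorem prod_gaussian_kernel_constants {d : ℕ} (ξ μ : Fin d → ℝ) {σ ν : ℝ} (hσ : 0 < σ)
    (hν : 0 < ν) :
    ∏ l, (ν / √(ν ^ 2 + σ ^ 2) * Real.exp (-(ξ l - μ l) ^ 2 / (2 * (ν ^ 2 + σ ^ 2)))) =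
      (ν ^ 2 / (ν ^ 2 + σ ^ 2)) ^ ((d : ℝ) / 2) *
        Real.exp (-(∑ j, (ξ j - μ j) ^ 2) / (2 * (ν ^ 2 + σ ^ 2))) := by
  have hs : 0 < ν ^ 2 + σ ^ 2 := by positivity
  have hbase : ν ^ 2 / (ν ^ 2 + σ ^ 2) = (ν / √(ν ^ 2 + σ ^ 2)) ^ (2 : ℝ) := by
    rw [Real.rpow_two, div_pow, Real.sq_sqrt hs.le]
  rw [Finset.prod_mul_distrib, ← Real.exp_sum, ← Finset.sum_div, Finset.sum_neg_distrib, hbase,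
    ← Real.rpow_mul (by positivity), mul_div_cancel₀ _ two_ne_zero, Real.rpow_natCast,
    Finset.prod_const, Finset.card_univ, Fintype.card_fin]

/-- The change of variables that centres the features distorts squared norms by at most
`d + 2`. -/
theorem sum_sq_le_mul_sum_sq_centered {d : ℕ} {α : Fin d → ℝ} (hα : ∀ j, α j ∈ Set.Icc (0 : ℝ) 1)
    (v : Fin (d + 1) → ℝ) :
    ∑ a, v a ^ 2 ≤ (d + 2) *
      ∑ a, (Fin.cons (v 0 + ∑ j, α j * v j.succ) (fun j => v j.succ) : Fin (d + 1) → ℝ) a ^ 2 := by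
  simp only [Fin.sum_univ_succ, Fin.cons_zero, Fin.cons_succ]
  set r := ∑ j, α j * v j.succ
  set N := ∑ j : Fin d, v j.succ ^ 2
  have hr : r ^ 2 ≤ d * N := by
    refine (Finset.sum_mul_sq_le_sq_mul_sq Finset.univ α fun j => v j.succ).trans ?_
    refine mul_le_mul_of_nonneg_right ?_ (Finset.sum_nonneg fun _ _ => sq_nonneg _)
    have : ∑ j, α j ^ 2 ≤ ∑ _j : Fin d, (1 : ℝ) :=
      Finset.sum_le_sum fun j _ => pow_le_one₀ (hα j).1 (hα j).2
    simpa using this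
  have hd0 : (0 : ℝ) ≤ d := Nat.cast_nonneg d
  rcases hd0.eq_or_lt with h0 | h0
  · rw [← h0] at hr ⊢
    have : r = 0 := by nlinarith [sq_nonneg r]
    rw [this]
    nlinarith [sq_nonneg (v 0),
      Finset.sum_nonneg fun j (_ : j ∈ Finset.univ) => sq_nonneg (v (Fin.succ j))]
  · have h3 : v 0 ^ 2 ≤ (d + 1) * (v 0 + r) ^ 2 + (1 + 1 / d) * r ^ 2 := by
      have : (d + 1) * (v 0 + r) ^ 2 + (1 + 1 / d) * r ^ 2 - v 0 ^ 2 =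
          (d * (v 0 + r) + r) ^ 2 / d := by
        field_simp
        ring
      have h4 : 0 ≤ (d * (v 0 + r) + r) ^ 2 / d := by positivity
      linarith
    have h5 : (1 + 1 / (d : ℝ)) * r ^ 2 ≤ (d + 1) * N := by
      calc (1 + 1 / (d : ℝ)) * r ^ 2 ≤ (1 + 1 / d) * (d * N) := by gcongr
        _ = (d + 1) * N := by field_simp
    nlinarith [sq_nonneg (v 0 + r)]

/-- The quadratic form of a weighted empirical covariance matrix. -/
theorem dotProduct_weighted_covariance_mulVec {n m : ℕ} (c : ℝ) (p : Fin n → ℝ)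
    (z : Fin n → Fin m → ℝ) (v : Fin m → ℝ) :
    v ⬝ᵥ (c • ∑ i, p i • vecMulVec (z i) (z i)) *ᵥ v = c * ∑ i, p i * (v ⬝ᵥ z i) ^ 2 := by
  simp only [smul_mulVec, sum_mulVec, dotProduct_smul, dotProduct_sum, vecMulVec_mulVec,
    smul_eq_mul, op_smul_eq_smul]
  congr 1
  refine Finset.sum_congr rfl fun i _ => ?_
  rw [dotProduct_comm (z i) v]
  ring

/-- Expansion of a weighted sum of squared linear forms as a quadratic form. -/
theorem mul_sum_mul_sq_sum {n m : ℕ} (c : ℝ) (p : Fin n → ℝ) (z : Fin n → Fin m → ℝ)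
    (w : Fin m → ℝ) :
    c * ∑ i, p i * (∑ a, w a * z i a) ^ 2 =
      ∑ a, ∑ b, w a * w b * (c * ∑ i, p i * (z i a * z i b)) := by
  simp only [sq, Finset.sum_mul_sum]
  simp only [Finset.mul_sum]
  rw [Finset.sum_comm]
  refine Finset.sum_congr rfl fun a _ => ?_
  rw [Finset.sum_comm]
  exact Finset.sum_congr rfl fun b _ => Finset.sum_congr rfl fun i _ => by ring

/-- If finitely many exceptional events cover the complement of `s`, each of probability at most
`ε`, then `s` has probability at least `1 - card * ε`. -/
theorem one_sub_le_measure_of_exceptional {Ω ι : Type*} [MeasurableSpace Ω] [Fintype ι]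
    (P : Measure Ω) [IsProbabilityMeasure P] {s : Set Ω} (B : ι → Set Ω) {ε : ENNReal}
    (hB : ∀ i, P (B i) ≤ ε) (hs : ∀ ω, (∀ i, ω ∉ B i) → ω ∈ s) :
    1 - Fintype.card ι * ε ≤ P s := by
  rw [tsub_le_iff_right]
  calc (1 : ENNReal) = P Set.univ := measure_univ.symm
    _ ≤ P (s ∪ ⋃ i, B i) := measure_mono fun ω _ => by
      by_cases h : ∃ i, ω ∈ B i
      · exact Or.inr (Set.mem_iUnion.2 h)
      · exact Or.inl (hs ω (not_exists.1 h))
    _ ≤ P s + P (⋃ i, B i) := measure_union_le _ _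
    _ ≤ P s + ∑ i, P (B i) := by gcongr; exact measure_iUnion_fintype_le P B
    _ ≤ P s + Fintype.card ι * ε := by
      gcongr
      simpa using Finset.sum_le_sum fun i (_ : i ∈ Finset.univ) => hB i

/-- With probability at least `1 − 4d² exp(−2nt²)`, the empirical covariance matrix is
invertible and `‖Σ̂⁻¹‖_op ≤ 6 d A_d / C_d`. -/
theorem control_opNorm_empirical_covariance_inverse (d n : ℕ) (hd : 1 ≤ d) (hn : 1 ≤ n)
    (ξ μ : Fin d → ℝ) (σ ν : ℝ) (hσ : 0 < σ) (hν : 0 < ν)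
    (qm qp : Fin d → ℝ) (hq : ∀ j, qm j < qp j) (hqξ : ∀ j, qm j ≤ ξ j ∧ ξ j < qp j)
    (μt : Fin d → ℝ) (hμt : ∀ j, μt j = (ν ^ 2 * μ j + σ ^ 2 * ξ j) / (ν ^ 2 + σ ^ 2))
    (σt : ℝ) (hσt : σt = ν * σ / Real.sqrt (ν ^ 2 + σ ^ 2))
    (Cd : ℝ)
    (hCd : Cd = (ν ^ 2 / (ν ^ 2 + σ ^ 2)) ^ ((d : ℝ) / 2) *
        Real.exp (-(∑ j, (ξ j - μ j) ^ 2) / (2 * (ν ^ 2 + σ ^ 2))))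
    (α : Fin d → ℝ)
    (hα : ∀ j, α j = ∫ s in (qm j)..(qp j),
        Real.exp (-(s - μt j) ^ 2 / (2 * σt ^ 2)) / (σt * Real.sqrt (2 * Real.pi)))
    (hα01 : ∀ j, 0 < α j ∧ α j < 1)
    (A : ℝ)
    (hA : IsGreatest (Set.range fun j : Fin d => 1 / (α j * (1 - α j))) A)
    (ζ : (Fin d → ℝ) → Fin (d + 1) → ℝ)
    (hζ0 : ∀ x, ζ x 0 = 1)
    (hζs : ∀ x (j : Fin d), ζ x j.succ = if qm j ≤ x j ∧ x j < qp j then (1 : ℝ) else 0)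
    (Shat : (Fin n → Fin d → ℝ) → Matrix (Fin (d + 1)) (Fin (d + 1)) ℝ)
    (hShat : ∀ ω, Shat ω = (n : ℝ)⁻¹ •
        ∑ i, Real.exp (-(∑ j, (ω i j - ξ j) ^ 2) / (2 * ν ^ 2)) •
          Matrix.vecMulVec (ζ (ω i)) (ζ (ω i)))
    (P : Measure (Fin n → Fin d → ℝ))
    (hP : P = Measure.pi fun _ =>
        Measure.pi fun j => gaussianReal (μ j) ⟨σ ^ 2, sq_nonneg σ⟩)
    (t : ℝ) (ht : 0 < t) (ht' : t ≤ Cd / (6 * d * A)) :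
    1 - ENNReal.ofReal (4 * d ^ 2 * Real.exp (-2 * n * t ^ 2))
      ≤ P {ω | IsUnit (Shat ω) ∧ matOpNorm (Shat ω)⁻¹ ≤ 6 * d * A / Cd} := by
  have hd0 : (1 : ℝ) ≤ d := by exact_mod_cast hd
  have hα' : ∀ j, α j ∈ Set.Icc (0 : ℝ) 1 := fun j => ⟨(hα01 j).1.le, (hα01 j).2.le⟩
  have hCpos : 0 < Cd := by rw [hCd]; positivity
  have hσt0 : 0 < σt := by rw [hσt]; positivity
  have hAle : ∀ j, 1 / A ≤ α j * (1 - α j) := fun j => by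
    have hpos : 0 < α j * (1 - α j) := mul_pos (hα01 j).1 (sub_pos.2 (hα01 j).2)
    exact (one_div_le hpos ((one_div_pos.2 hpos).trans_le (hA.2 ⟨j, rfl⟩))).1 (hA.2 ⟨j, rfl⟩)
  have hA1 : 1 ≤ A := by
    have hpos : 0 < α ⟨0, hd⟩ * (1 - α ⟨0, hd⟩) :=
      mul_pos (hα01 _).1 (sub_pos.2 (hα01 _).2)
    refine le_trans ?_ (hA.2 ⟨⟨0, hd⟩, rfl⟩)
    rw [le_div_iff₀ hpos]
    nlinarith [sq_nonneg (α ⟨0, hd⟩), (hα01 ⟨0, hd⟩).2]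
  have hA0 : 0 < A := by linarith
  set e : Fin d → ℝ → ℝ := fun l y => Real.exp (-(y - ξ l) ^ 2 / (2 * ν ^ 2)) with he
  set u : Fin d → ℝ → ℝ := fun l y => (Set.Ico (qm l) (qp l)).indicator 1 y - α l with hu
  set v₀ : NNReal := ⟨σ ^ 2, sq_nonneg σ⟩
  have hv₀ : (v₀ : ℝ) = σ ^ 2 := rfl
  obtain ⟨w₀, hw₀⟩ : ∃ w₀ : NNReal, (w₀ : ℝ) = σt ^ 2 := ⟨⟨σt ^ 2, sq_nonneg σt⟩, rfl⟩
  set Q : Measure (Fin d → ℝ) := Measure.pi fun j => gaussianReal (μ j) v₀ with hQ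
  set c : Fin d → ℝ := fun l =>
    ν / √(ν ^ 2 + σ ^ 2) * Real.exp (-(ξ l - μ l) ^ 2 / (2 * (ν ^ 2 + σ ^ 2)))
  have hcC : ∏ l, c l = Cd := by rw [hCd, prod_gaussian_kernel_constants ξ μ hσ hν]
  have htilt : ∀ l (h : ℝ → ℝ), ∫ y, e l y * h y ∂gaussianReal (μ l) v₀ =
      c l * ∫ y, h y ∂gaussianReal (μt l) w₀ := fun l h => by
    rw [hμt, ← integral_exp_mul_gaussianReal (μ l) (ξ l) hσ hν hv₀ (hw₀.trans (by rw [hσt])) h]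
  have hmass : ∀ l, (gaussianReal (μt l) w₀).real (Set.Ico (qm l) (qp l)) = α l := fun l => by
    rw [hα, gaussianReal_real_Ico (μt l) hσt0 hw₀ (hq l).le]
  have hmoments := fun l => integral_indicator_sub_measureReal (gaussianReal (μt l) w₀)
    (measurableSet_Ico (a := qm l) (b := qp l))
  simp only [hmass] at hmoments
  have hmean : ∀ a b, ∫ x, (∏ l, e l (x l)) * (featureVec u x a * featureVec u x b) ∂Q =
      if a = b then Cd * (Fin.cons 1 (fun l => α l * (1 - α l)) : Fin (d + 1) → ℝ) a else 0 := by
    intro a b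
    rw [hQ, integral_prod_mul_featureVec _ e u c (fun l => α l * (1 - α l)) _ _ _ a b, hcC]
    · intro l
      simpa using htilt l fun _ => 1
    · intro l
      rw [htilt, (hmoments l).1, mul_zero]
    · intro l
      rw [htilt l fun y => u l y * u l y, (hmoments l).2]
  set S : (Fin n → Fin d → ℝ) → Fin (d + 1) → Fin (d + 1) → ℝ := fun ω a b =>
    (n : ℝ)⁻¹ * ∑ i, (∏ l, e l (ω i l)) * (featureVec u (ω i) a * featureVec u (ω i) b) with hS
  set sgn : Fin (d + 1) → Fin (d + 1) → ℝ := fun a b => if a < b then -1 else 1 with hsgn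
  set B : Fin (d + 1) × Fin (d + 1) → Set (Fin n → Fin d → ℝ) := fun ab =>
    {ω | sgn ab.1 ab.2 * S ω ab.1 ab.2 ≤ (∫ x, sgn ab.1 ab.2 * ((∏ l, e l (x l)) *
      (featureVec u x ab.1 * featureVec u x ab.2)) ∂Q) - t} with hBdef
  have hfeat : ∀ x a, featureVec u x a = -(Fin.cons 0 α : Fin (d + 1) → ℝ) a ∨
      featureVec u x a = 1 - (Fin.cons 0 α : Fin (d + 1) → ℝ) a := by
    intro x a
    refine Fin.cases ?_ (fun j => ?_) a
    · simp [featureVec]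
    · by_cases hx : x j ∈ Set.Ico (qm j) (qp j) <;> simp [featureVec, hu, hx]
  have hαcons : ∀ a, (Fin.cons 0 α : Fin (d + 1) → ℝ) a ∈ Set.Icc (0 : ℝ) 1 := fun a =>
    Fin.cases (by simp) (fun j => by simpa using hα' j) a
  have hweight : ∀ x : Fin d → ℝ, (∏ l, e l (x l)) ∈ Set.Icc (0 : ℝ) 1 := fun x =>
    ⟨Finset.prod_nonneg fun l _ => (Real.exp_pos _).le,
      Finset.prod_le_one (fun l _ => (Real.exp_pos _).le) fun l _ =>
        Real.exp_le_one_iff.2 (div_nonpos_of_nonpos_of_nonneg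
          (neg_nonpos.2 (sq_nonneg _)) (by positivity))⟩
  have hfeat_meas : ∀ a, Measurable fun x => featureVec u x a := by
    intro a
    refine Fin.cases ?_ (fun j => ?_) a
    · simp [featureVec]
    · simp only [featureVec, Fin.cons_succ, hu]
      exact ((measurable_one.indicator measurableSet_Ico).comp (measurable_pi_apply j)).sub_const _
  have hB : ∀ ab, P (B ab) ≤ ENNReal.ofReal (Real.exp (-2 * n * t ^ 2)) := by
    rintro ⟨a, b⟩
    obtain ⟨lo, hlo⟩ := exists_interval_mul_centered (hαcons a) (hαcons b)
    have hmeas : Measurable fun x : Fin d → ℝ => sgn a b * ((∏ l, e l (x l)) *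
        (featureVec u x a * featureVec u x b)) := by
      have := hfeat_meas a
      have := hfeat_meas b
      fun_prop
    have hrange : ∃ lo' : ℝ, ∀ x : Fin d → ℝ, sgn a b * ((∏ l, e l (x l)) *
        (featureVec u x a * featureVec u x b)) ∈ Set.Icc lo' (lo' + 1) := by
      have hlo' := fun x => hlo _ (hweight x) _ _ (hfeat x a) (hfeat x b)
      by_cases hab : a < b
      · refine ⟨-(lo + 1), fun x => ?_⟩
        simp only [hsgn, hab, if_true]
        constructor <;> linarith [(hlo' x).1, (hlo' x).2]
      · exact ⟨lo, fun x => by simpa only [hsgn, hab, if_false, one_mul] using hlo' x⟩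
    obtain ⟨lo', hlo'⟩ := hrange
    have key := hoeffding_empirical_mean Q hn hmeas hlo' ht.le
    rw [hP]
    convert key using 5 with ω
    simp only [hS, ← Finset.mul_sum]
    ring
  have : IsProbabilityMeasure P := by rw [hP]; infer_instance
  refine le_trans ?_ (one_sub_le_measure_of_exceptional P B hB fun ω hω => ?_)
  · refine tsub_le_tsub_left ?_ _
    rw [← ENNReal.ofReal_natCast, ← ENNReal.ofReal_mul (by positivity)]
    refine ENNReal.ofReal_le_ofReal (mul_le_mul_of_nonneg_right ?_ (Real.exp_pos _).le)
    simp only [Fintype.card_prod, Fintype.card_fin]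
    push_cast
    nlinarith
  have hSsymm : ∀ a b, S ω a b = S ω b a := fun a b => by
    simp only [hS, mul_comm (featureVec u _ a)]
  have hgood : ∀ a b, sgn a b * (∫ x, (∏ l, e l (x l)) * (featureVec u x a * featureVec u x b) ∂Q)
      - t < sgn a b * S ω a b := fun a b => by
    have := hω (a, b)
    simpa only [hBdef, Set.mem_ofPred_eq, not_le, integral_const_mul] using this
  have hdiag : ∀ a, Cd / A - t ≤ S ω a a := by
    intro a
    have h1 := hgood a a
    simp only [hmean, hsgn, lt_irrefl, if_true, if_false, one_mul] at h1
    have h2 : 1 / A ≤ (Fin.cons 1 (fun l => α l * (1 - α l)) : Fin (d + 1) → ℝ) a :=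
      Fin.cases (by rw [Fin.cons_zero, div_le_one hA0]; exact hA1)
        (fun j => by simpa using hAle j) a
    have h3 := mul_le_mul_of_nonneg_left h2 hCpos.le
    rw [mul_one_div] at h3
    linarith
  have hupper : ∀ a b, a < b → |S ω a b| ≤ t := by
    intro a b hab
    have h1 := hgood a b
    have h2 := hgood b a
    rw [hSsymm b a] at h2
    simp only [hmean, hsgn, hab, hab.ne, hab.ne', hab.not_gt, if_true, if_false] at h1 h2
    rw [abs_le]
    constructor <;> linarith
  have hoff : ∀ a b, a ≠ b → |S ω a b| ≤ t := fun a b hab =>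
    hab.lt_or_gt.elim (hupper a b) fun h => hSsymm a b ▸ hupper b a h
  rw [Set.mem_ofPred_eq, ← inv_div]
  refine isUnit_and_matOpNorm_inv_le (by positivity) fun v => ?_
  set w : Fin (d + 1) → ℝ := Fin.cons (v 0 + ∑ j, α j * v j.succ) (fun j => v j.succ) with hw
  have hdot : ∀ x, v ⬝ᵥ ζ x = ∑ a, w a * featureVec u x a := by
    intro x
    simp only [dotProduct, Fin.sum_univ_succ, hw, Fin.cons_zero, Fin.cons_succ, featureVec, hζ0,
      hζs, hu, mul_one, mul_sub, Finset.sum_sub_distrib, Set.indicator_apply, Set.mem_Ico,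
      Pi.one_apply, mul_comm (α _)]
    ring
  have hweight_eq : ∀ x : Fin d → ℝ,
      Real.exp (-(∑ j, (x j - ξ j) ^ 2) / (2 * ν ^ 2)) = ∏ l, e l (x l) := fun x => by
    rw [he, ← Real.exp_sum, ← Finset.sum_div, Finset.sum_neg_distrib]
  have hform : v ⬝ᵥ Shat ω *ᵥ v = ∑ a, ∑ b, w a * w b * S ω a b := by
    rw [hShat, dotProduct_weighted_covariance_mulVec]
    simp only [hdot, hweight_eq]
    exact mul_sum_mul_sq_sum _ _ _ _
  have hvv : v ⬝ᵥ v = ∑ a, v a ^ 2 := by simp [dotProduct, sq]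
  have hquad := quadratic_form_ge_of_entries ht.le hdiag hoff w
  have hnorm := sum_sq_le_mul_sum_sq_centered hα' v
  rw [← hw] at hnorm
  rw [hform, hvv]
  refine le_trans ?_ hquad
  have hw0 : 0 ≤ ∑ a, w a ^ 2 := Finset.sum_nonneg fun _ _ => sq_nonneg _
  have ht1 : t * (6 * d) ≤ Cd / A := by
    rw [le_div_iff₀ (by positivity)] at ht'
    rw [le_div_iff₀ hA0]
    linarith
  have hlow : 2 / 3 * (Cd / A) ≤ Cd / A - ((d + 1 : ℕ) : ℝ) * t := by
    push_cast
    nlinarith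
  calc Cd / (6 * d * A) * ∑ a, v a ^ 2
      ≤ Cd / (6 * d * A) * ((d + 2) * ∑ a, w a ^ 2) := by gcongr
    _ ≤ Cd / (6 * d * A) * ((3 * d) * ∑ a, w a ^ 2) := by gcongr; linarith
    _ = 1 / 2 * (Cd / A) * ∑ a, w a ^ 2 := by field_simp; ring
    _ ≤ (Cd / A - ((d + 1 : ℕ) : ℝ) * t) * ∑ a, w a ^ 2 := by
      gcongr
      have : 0 < Cd / A := by positivity
      linarith
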